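/- arXiv:1101.1246 — 2 statements merged into one kernel-verified Lean document; each statement's English description precedes it below -/
import Mathlib

section
/- Let M be an invertible symmetric n×n matrix over GF(2). Then M ∼_piv M^{-1}: that is, M^{-1} can be obtained from M by a finite sequence of operations, each of which is either a non-simple local complementation at an index whose diagonal entry is 1, or a pivot at a pair of indices i ≠ j whose diagonal entries are 0 and whose off-diagonal entry is 1. -/
open Matrix

/-- The simple local complement of `S` at `i`: toggle `S j k` whenever
`j ≠ k`, `i ∉ {j, k}`, and `S i j ≠ 0 ≠ S i k`. -/
def slc {n : Type*} [DecidableEq n] (S : Matrix n n (ZMod 2)) (i : n) :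
    Matrix n n (ZMod 2) :=
  fun j k => if j ≠ k ∧ i ≠ j ∧ i ≠ k then S j k + S i j * S i k else S j k

/-- The non-simple local complement of `S` at `i`: toggle `S j k` whenever
`j ≠ i ≠ k` (including `j = k`) and `S i j ≠ 0 ≠ S i k`; row `i` and column `i`
are unchanged. -/
def nslc {n : Type*} [DecidableEq n] (S : Matrix n n (ZMod 2)) (i : n) :
    Matrix n n (ZMod 2) :=
  fun j k => if j ≠ i ∧ k ≠ i then S j k + S i j * S i k else S j k

/-- A single step of the `∼_piv` relation: either a non-simple local complementation
at a looped index (`S i i = 1`), or a pivot `S ↦ S^{ij} = ((S^i)^j)^i` at an unlooped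
edge (`S i i = S j j = 0`, `S i j = 1`). -/
def PivStep {n : Type*} [DecidableEq n] (S T : Matrix n n (ZMod 2)) : Prop :=
  (∃ i, S i i = 1 ∧ T = nslc S i) ∨
  (∃ i j, i ≠ j ∧ S i i = 0 ∧ S j j = 0 ∧ S i j = 1 ∧ T = slc (slc (slc S i) j) i)

/-- `S ∼_piv T` : `T` is obtained from `S` by a finite sequence of non-simple local
complementations at looped indices and pivots at unlooped edges. -/
def PivRel {n : Type*} [DecidableEq n] (S T : Matrix n n (ZMod 2)) : Prop :=
  Relation.ReflTransGen PivStep S T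

/-- `T` is the principal pivot transform of `S` on `X`: it maps `y` to `z` exactly when `y`, `z`
arise from some `x`, `S x` by exchanging the coordinates in `X`. -/
def IsPrincipalPivot {n : Type*} [Fintype n] [DecidableEq n] (X : Finset n)
    (S T : Matrix n n (ZMod 2)) : Prop :=
  ∀ x : n → ZMod 2, T *ᵥ X.piecewise (S *ᵥ x) x = X.piecewise x (S *ᵥ x)

section

variable {n : Type*} [DecidableEq n] {S T : Matrix n n (ZMod 2)} {i j : n}

/-- The `i`-th row of `S + 1`. -/
def shiftedRow (S : Matrix n n (ZMod 2)) (i : n) : n → ZMod 2 :=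
  S i + Pi.single i 1

theorem nslc_eq_add_vecMulVec (hS : S.IsSymm) (hi : S i i = 1) :
    nslc S i = S + vecMulVec (shiftedRow S i) (shiftedRow S i) := by
  ext p q
  have two : (1 + 1 : ZMod 2) = 0 := by decide
  have hp := hS.apply p i
  by_cases h1 : p = i <;> by_cases h2 : q = i <;>
    simp_all [nslc, shiftedRow, vecMulVec_apply]

theorem slc_slc_slc_eq_add_vecMulVec (hS : S.IsSymm) (hij : i ≠ j) (hi : S i i = 0)
    (hj : S j j = 0) (h : S i j = 1) :
    slc (slc (slc S i) j) i = S + vecMulVec (shiftedRow S i) (shiftedRow S j)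
      + vecMulVec (shiftedRow S j) (shiftedRow S i) := by
  ext p q
  have h' : S j i = 1 := by rw [hS.apply, h]
  have two : ∀ a : ZMod 2, a + a = 0 := by decide
  have hpi := hS.apply p i
  have hpj := hS.apply p j
  have hqi := hS.apply q i
  have hqj := hS.apply q j
  by_cases h1 : p = i <;> by_cases h2 : q = i <;> by_cases h3 : p = j <;> by_cases h4 : q = j <;>
    by_cases h5 : p = q <;>
    simp_all [slc, shiftedRow, vecMulVec_apply]
  all_goals grind

theorem Matrix.IsSymm.nslc (hS : S.IsSymm) (hi : S i i = 1) : (nslc S i).IsSymm := by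
  rw [nslc_eq_add_vecMulVec hS hi]
  exact hS.add (transpose_vecMulVec _ _)

theorem Matrix.IsSymm.slc_slc_slc (hS : S.IsSymm) (hij : i ≠ j) (hi : S i i = 0)
    (hj : S j j = 0) (h : S i j = 1) : (slc (slc (slc S i) j) i).IsSymm := by
  rw [slc_slc_slc_eq_add_vecMulVec hS hij hi hj h, IsSymm, transpose_add, transpose_add,
    transpose_vecMulVec, transpose_vecMulVec, hS.eq]
  abel

variable [Fintype n]

theorem shiftedRow_dotProduct (x : n → ZMod 2) :
    shiftedRow S i ⬝ᵥ x = (S *ᵥ x) i + x i := by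
  simp [shiftedRow, add_dotProduct, mulVec]

theorem isPrincipalPivot_nslc (hS : S.IsSymm) (hi : S i i = 1) :
    IsPrincipalPivot {i} (nslc S i) S := by
  intro x
  set T := nslc S i with hT
  have hTx : T *ᵥ x = S *ᵥ x + ((S *ᵥ x) i + x i) • shiftedRow S i := by
    rw [hT, nslc_eq_add_vecMulVec hS hi, add_mulVec, vecMulVec_mulVec, shiftedRow_dotProduct]
    ext; simp [mul_comm]
  have hx : ({i} : Finset n).piecewise (T *ᵥ x) x =
      x + Pi.single i ((S *ᵥ x) i + x i) := by
    have key : ∀ a b : ZMod 2, a + (a + b + (a + b)) = b + (a + b) := by decide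
    ext k
    by_cases hk : k = i
    · subst hk; simp [hTx, shiftedRow, hi, key]
    · simp [hk]
  rw [hx, mulVec_add]
  have key : ∀ a b : ZMod 2, a + (a + b) = b := by decide
  ext k
  by_cases hk : k = i
  · subst hk; simp [hi, key]
  · simp [hk, hTx, shiftedRow, hS.apply i k, mul_comm]

theorem isPrincipalPivot_slc_slc_slc (hS : S.IsSymm) (hij : i ≠ j) (hi : S i i = 0)
    (hj : S j j = 0) (h : S i j = 1) :
    IsPrincipalPivot {i, j} (slc (slc (slc S i) j) i) S := by
  intro x
  have h' : S j i = 1 := by rw [hS.apply, h]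
  set T := slc (slc (slc S i) j) i with hT
  have hTx : T *ᵥ x = S *ᵥ x + ((S *ᵥ x) j + x j) • shiftedRow S i
      + ((S *ᵥ x) i + x i) • shiftedRow S j := by
    rw [hT, slc_slc_slc_eq_add_vecMulVec hS hij hi hj h, add_mulVec, add_mulVec,
      vecMulVec_mulVec, vecMulVec_mulVec, shiftedRow_dotProduct, shiftedRow_dotProduct]
    ext; simp [mul_comm]
  have hx : ({i, j} : Finset n).piecewise (T *ᵥ x) x =
      x + Pi.single i ((S *ᵥ x) j + x j) + Pi.single j ((S *ᵥ x) i + x i) := by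
    have key : ∀ a b c d : ZMod 2, a + (c + d) + (a + b) = b + (c + d) := by decide
    have key' : ∀ a b c d : ZMod 2, c + (c + d) + (a + b) = d + (a + b) := by decide
    ext k
    by_cases hk : k = i
    · subst hk; simp [hTx, shiftedRow, hi, h', hij, key]
    · by_cases hk' : k = j
      · subst hk'; simp [hTx, shiftedRow, hj, h, hk, key']
      · simp [hk, hk']
  rw [hx, mulVec_add, mulVec_add]
  have key : ∀ a b : ZMod 2, a + (a + b) = b := by decide
  ext k
  by_cases hk : k = i
  · subst hk; simp [hi, h, key]
  · by_cases hk' : k = j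
    · subst hk'; simp [hj, h', key]
    · simp [hk, hk', hTx, shiftedRow, hS.apply i k, hS.apply j k, mul_comm]

theorem IsPrincipalPivot.sdiff {X Y : Finset n} {S' : Matrix n n (ZMod 2)} (hYX : Y ⊆ X)
    (hY : IsPrincipalPivot Y S' S) (hX : IsPrincipalPivot X S T) :
    IsPrincipalPivot (X \ Y) S' T := by
  intro x
  have hx := hX (Y.piecewise (S' *ᵥ x) x)
  rw [hY x] at hx
  have hswap : ∀ y z : n → ZMod 2,
      X.piecewise (Y.piecewise y z) (Y.piecewise z y) = (X \ Y).piecewise z y := by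
    intro y z
    ext k
    by_cases hk : k ∈ Y
    · simp [hk, hYX hk]
    · by_cases hk' : k ∈ X <;> simp [hk, hk']
  rwa [hswap, hswap] at hx

theorem IsPrincipalPivot.exists_ne_zero {X : Finset n} (hX : IsPrincipalPivot X S T)
    (hi : i ∈ X) : ∃ j ∈ X, S j i ≠ 0 := by
  by_contra! hzero
  have hx := congrFun (hX (Pi.single i 1)) i
  have h0 : X.piecewise (S *ᵥ Pi.single i 1) (Pi.single i 1) = (0 : n → ZMod 2) := by
    ext k
    by_cases hk : k ∈ X
    · simp [hk, hzero k hk]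
    · simp [hk, ne_of_mem_of_not_mem hi hk |>.symm]
  rw [h0] at hx
  simp [hi] at hx

theorem IsPrincipalPivot.pivRel {X : Finset n} (hS : S.IsSymm) (hX : IsPrincipalPivot X S T) :
    PivRel S T := by
  have cases01 : ∀ a : ZMod 2, a ≠ 0 → a = 1 := by decide
  induction X using Finset.strongInduction generalizing S with
  | H X ih =>
    obtain rfl | ⟨i, hi⟩ := X.eq_empty_or_nonempty
    · have hTS : T = S := ext_of_mulVec_single fun k => by simpa using hX (Pi.single k 1)
      exact hTS ▸ Relation.ReflTransGen.refl
    by_cases hloop : ∃ k ∈ X, S k k = 1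
    · obtain ⟨k, hk, hkk⟩ := hloop
      have hsub : {k} ⊆ X := by simpa using hk
      exact .head (.inl ⟨k, hkk, rfl⟩) <| ih _ (Finset.sdiff_ssubset hsub (by simp))
        (hS.nslc hkk) ((isPrincipalPivot_nslc hS hkk).sdiff hsub hX)
    · have hdiag : ∀ k ∈ X, S k k = 0 := fun k hk => by
        by_contra hne
        exact hloop ⟨k, hk, cases01 _ hne⟩
      obtain ⟨j, hj, hji⟩ := hX.exists_ne_zero hi
      have hne : j ≠ i := by
        rintro rfl
        exact hji (hdiag _ hj)
      have hji := cases01 _ hji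
      have hsub : {j, i} ⊆ X := by simp [Finset.insert_subset_iff, hi, hj]
      exact .head (.inr ⟨j, i, hne, hdiag j hj, hdiag i hi, hji, rfl⟩) <|
        ih _ (Finset.sdiff_ssubset hsub (by simp))
        (hS.slc_slc_slc hne (hdiag j hj) (hdiag i hi) hji)
        ((isPrincipalPivot_slc_slc_slc hS hne (hdiag j hj) (hdiag i hi) hji).sdiff hsub hX)

end

/-- **Theorem (Statement 17).** Every invertible symmetric matrix over `GF(2)`
satisfies `M ∼_piv M⁻¹`. -/
theorem pivRel_inv {n : Type*} [Fintype n] [DecidableEq n]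
    (M : Matrix n n (ZMod 2)) (hM : M.IsSymm) (hunit : IsUnit M) :
    PivRel M M⁻¹ := by
  have hdet : IsUnit M.det := (isUnit_iff_isUnit_det M).mp hunit
  have hpivot : IsPrincipalPivot Finset.univ M M⁻¹ := fun x => by
    simp [nonsing_inv_mul M hdet]
  exact hpivot.pivRel hM
end

section
/- Let S and T be zero-diagonal symmetric matrices over GF(2), and let S′ and T′ be symmetric matrices over GF(2) that agree with S and T respectively in all off-diagonal entries (their diagonal entries may be arbitrary). If S′ ∼_piv T′, then S ∼_lc T. -/
open Matrix

/-- `S ∼_lc T` : `T` is obtained from `S` by a finite sequence of simple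
local complementations. -/
def LCRel {n : Type*} [DecidableEq n] (S T : Matrix n n (ZMod 2)) : Prop :=
  Relation.ReflTransGen (fun A B : Matrix n n (ZMod 2) => ∃ i, B = slc A i) S T

/-- The matrix `A` with its diagonal entries replaced by `0`. -/
def zeroDiag {n : Type*} [DecidableEq n] (A : Matrix n n (ZMod 2)) : Matrix n n (ZMod 2) :=
  fun j k => if j = k then 0 else A j k

theorem zeroDiag_slc {n : Type*} [DecidableEq n] (A : Matrix n n (ZMod 2)) (i : n) :
    zeroDiag (slc A i) = slc (zeroDiag A) i := by
  ext j k
  unfold zeroDiag slc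
  grind

theorem zeroDiag_nslc {n : Type*} [DecidableEq n] (A : Matrix n n (ZMod 2)) (i : n) :
    zeroDiag (nslc A i) = slc (zeroDiag A) i := by
  ext j k
  unfold zeroDiag slc nslc
  grind

theorem eq_zeroDiag {n : Type*} [DecidableEq n] {A A' : Matrix n n (ZMod 2)}
    (h0 : ∀ i, A i i = 0) (h : ∀ j k, j ≠ k → A' j k = A j k) : A = zeroDiag A' := by
  ext j k
  unfold zeroDiag
  grind

theorem LCRel.slc {n : Type*} [DecidableEq n] {A B : Matrix n n (ZMod 2)} (h : LCRel A B)
    (i : n) : LCRel A (slc B i) :=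
  Relation.ReflTransGen.tail h ⟨i, rfl⟩

theorem PivRel.lcRel_zeroDiag {n : Type*} [DecidableEq n] {A B : Matrix n n (ZMod 2)}
    (h : PivRel A B) : LCRel (zeroDiag A) (zeroDiag B) := by
  induction h with
  | refl => exact Relation.ReflTransGen.refl
  | tail _ step ih =>
    rcases step with ⟨i, -, rfl⟩ | ⟨i, j, -, -, -, -, rfl⟩
    · rw [zeroDiag_nslc]
      exact ih.slc i
    · simp only [zeroDiag_slc]
      exact ((ih.slc i).slc j).slc i

/-- **Theorem (Statement 18).** Let `S, T` be zero-diagonal symmetric matrices over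
`GF(2)`, and let `S′, T′` be symmetric matrices agreeing with `S, T` respectively in
all off-diagonal entries.  If `S′ ∼_piv T′`, then `S ∼_lc T`. -/
theorem lc_of_piv {n : Type*} [DecidableEq n]
    (S T S' T' : Matrix n n (ZMod 2))
    (hS : S.IsSymm) (hS0 : ∀ i, S i i = 0)
    (hT : T.IsSymm) (hT0 : ∀ i, T i i = 0)
    (hS' : S'.IsSymm) (hT' : T'.IsSymm)
    (hSS' : ∀ j k, j ≠ k → S' j k = S j k)
    (hTT' : ∀ j k, j ≠ k → T' j k = T j k)
    (h : PivRel S' T') : LCRel S T := by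
  rw [eq_zeroDiag hS0 hSS', eq_zeroDiag hT0 hTT']
  exact h.lcRel_zeroDiag
end
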